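/- arXiv:2103.16941 — 5 statements merged into one kernel-verified Lean document; each statement's English description precedes it below -/
import Mathlib

section
/- Let λ, C ∈ ℂ and let u, v, U, V, S : ℝ² → ℂ be smooth functions of (x,t) such that S is nowhere zero, S² = C − UV everywhere, and the four equations U_x = λU − 2uS, V_x = −λV − 2vS, iU_t = (2uv + λ²)U − 2(u_x + λu)S, iV_t = −(2uv + λ²)V + 2(v_x − λv)S hold on ℝ². Then u and v satisfy the NLS system: iu_t = u_xx + 2u²v and iv_t = −v_xx − 2v²u. (This is the 'only if' direction of the statement that the nonlinear Lax pair is compatible exactly on solutions of NLS.) -/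
open Complex

/-- Partial derivative with respect to the first variable `x`. -/
noncomputable def dX (f : ℝ → ℝ → ℂ) : ℝ → ℝ → ℂ := fun x t => deriv (fun y => f y t) x

/-- Partial derivative with respect to the second variable `t`. -/
noncomputable def dT (f : ℝ → ℝ → ℂ) : ℝ → ℝ → ℂ := fun x t => deriv (fun s => f x s) t

/-- `f` is a smooth function of `(x,t) ∈ ℝ²`. -/
def Smooth2 (f : ℝ → ℝ → ℂ) : Prop := ContDiff ℝ (⊤ : ℕ∞) (fun p : ℝ × ℝ => f p.1 p.2)

namespace Smooth2

variable {f : ℝ → ℝ → ℂ}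

theorem hasFDerivAt (hf : Smooth2 f) (p : ℝ × ℝ) :
    HasFDerivAt (fun p : ℝ × ℝ => f p.1 p.2)
      (fderiv ℝ (fun p : ℝ × ℝ => f p.1 p.2) p) p :=
  (ContDiff.differentiable hf (by simp) p).hasFDerivAt

theorem hasDerivAt_fst (hf : Smooth2 f) (x t : ℝ) :
    HasDerivAt (fun y => f y t) (fderiv ℝ (fun p : ℝ × ℝ => f p.1 p.2) (x, t) (1, 0)) x :=
  (hf.hasFDerivAt (x, t)).comp_hasDerivAt (f := fun y => (y, t)) x
    ((hasDerivAt_id x).prodMk (hasDerivAt_const x t))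

theorem hasDerivAt_snd (hf : Smooth2 f) (x t : ℝ) :
    HasDerivAt (fun s => f x s) (fderiv ℝ (fun p : ℝ × ℝ => f p.1 p.2) (x, t) (0, 1)) t :=
  (hf.hasFDerivAt (x, t)).comp_hasDerivAt (f := fun s => (x, s)) t
    ((hasDerivAt_const t x).prodMk (hasDerivAt_id t))

theorem dX_eq (hf : Smooth2 f) (x t : ℝ) :
    dX f x t = fderiv ℝ (fun p : ℝ × ℝ => f p.1 p.2) (x, t) (1, 0) :=
  (hf.hasDerivAt_fst x t).deriv

theorem dT_eq (hf : Smooth2 f) (x t : ℝ) :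
    dT f x t = fderiv ℝ (fun p : ℝ × ℝ => f p.1 p.2) (x, t) (0, 1) :=
  (hf.hasDerivAt_snd x t).deriv

theorem hasDerivAt_dX (hf : Smooth2 f) (x t : ℝ) :
    HasDerivAt (fun y => f y t) (dX f x t) x :=
  hf.dX_eq x t ▸ hf.hasDerivAt_fst x t

theorem hasDerivAt_dT (hf : Smooth2 f) (x t : ℝ) :
    HasDerivAt (fun s => f x s) (dT f x t) t :=
  hf.dT_eq x t ▸ hf.hasDerivAt_snd x t

theorem contDiff_fderiv (hf : Smooth2 f) :
    ContDiff ℝ (⊤ : ℕ∞) (fderiv ℝ (fun p : ℝ × ℝ => f p.1 p.2)) :=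
  ContDiff.fderiv_right hf (by simp)

theorem dX (hf : Smooth2 f) : Smooth2 (dX f) := by
  unfold Smooth2
  simp only [hf.dX_eq]
  exact hf.contDiff_fderiv.clm_apply contDiff_const

theorem dT (hf : Smooth2 f) : Smooth2 (dT f) := by
  unfold Smooth2
  simp only [hf.dT_eq]
  exact hf.contDiff_fderiv.clm_apply contDiff_const

/-- Mixed partial derivatives of a smooth function commute. -/
theorem dT_dX (hf : Smooth2 f) (x t : ℝ) :
    _root_.dT (_root_.dX f) x t = _root_.dX (_root_.dT f) x t := by
  have hd (p : ℝ × ℝ) : DifferentiableAt ℝ (fderiv ℝ (fun p : ℝ × ℝ => f p.1 p.2)) p :=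
    hf.contDiff_fderiv.differentiable (by simp) p
  have hsymm : IsSymmSndFDerivAt ℝ (fun p : ℝ × ℝ => f p.1 p.2) (x, t) :=
    (ContDiff.contDiffAt hf).isSymmSndFDerivAt
      (by simpa using WithTop.coe_le_coe.2 (le_top : (2 : ℕ∞) ≤ ⊤))
  rw [hf.dX.dT_eq, hf.dT.dX_eq]
  simp only [hf.dX_eq, hf.dT_eq]
  rw [fderiv_clm_apply (hd _) (by fun_prop), fderiv_clm_apply (hd _) (by fun_prop)]
  simpa using hsymm (0, 1) (1, 0)

end Smooth2

/-- One half of the compatibility computation, with an arbitrary constant `c` in place of `±i`: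
the two halves of the system are exchanged by `(u, v, U, V, lam, c) ↦ (v, u, V, U, -lam, -c)`. -/
theorem evolution_of_compatible (c lam C : ℂ) (u v U V S : ℝ → ℝ → ℂ)
    (hu : Smooth2 u) (hv : Smooth2 v) (hU : Smooth2 U) (hV : Smooth2 V) (hS : Smooth2 S)
    (hSne : ∀ x t, S x t ≠ 0)
    (hS2 : ∀ x t, (S x t) ^ 2 = C - U x t * V x t)
    (hUx : ∀ x t, dX U x t = lam * U x t - 2 * u x t * S x t)
    (hVx : ∀ x t, dX V x t = -lam * V x t - 2 * v x t * S x t)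
    (hUt : ∀ x t, c * dT U x t =
      (2 * u x t * v x t + lam ^ 2) * U x t - 2 * (dX u x t + lam * u x t) * S x t)
    (hVt : ∀ x t, c * dT V x t =
      -(2 * u x t * v x t + lam ^ 2) * V x t + 2 * (dX v x t - lam * v x t) * S x t)
    (x t : ℝ) : c * dT u x t = dX (dX u) x t + 2 * (u x t) ^ 2 * v x t := by
  have hSx : dX S x t = u x t * V x t + v x t * U x t := by
    have h := (hS.hasDerivAt_dX x t).fun_pow 2
    simp only [hS2] at h
    have h' := h.unique (((hU.hasDerivAt_dX x t).fun_mul (hV.hasDerivAt_dX x t)).const_sub C)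
    rw [hUx, hVx] at h'
    apply mul_left_cancel₀ (mul_ne_zero two_ne_zero (hSne x t))
    push_cast at h'
    linear_combination h'
  have hSt : c * dT S x t =
      (dX u x t + lam * u x t) * V x t - (dX v x t - lam * v x t) * U x t := by
    have h := (hS.hasDerivAt_dT x t).fun_pow 2
    simp only [hS2] at h
    have h' := h.unique (((hU.hasDerivAt_dT x t).fun_mul (hV.hasDerivAt_dT x t)).const_sub C)
    apply mul_left_cancel₀ (mul_ne_zero two_ne_zero (hSne x t))
    push_cast at h'
    linear_combination c * h' - V x t * hUt x t - U x t * hVt x t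
  have hxt : dT (dX U) x t =
      lam * dT U x t - (2 * dT u x t * S x t + 2 * u x t * dT S x t) := by
    have h := hU.dX.hasDerivAt_dT x t
    simp only [hUx] at h
    exact h.unique (((hU.hasDerivAt_dT x t).const_mul lam).fun_sub
      (((hu.hasDerivAt_dT x t).const_mul 2).fun_mul (hS.hasDerivAt_dT x t)))
  have htx : c * dX (dT U) x t =
      2 * (dX u x t * v x t + u x t * dX v x t) * U x t
        + (2 * u x t * v x t + lam ^ 2) * dX U x t
        - (2 * (dX (dX u) x t + lam * dX u x t) * S x t
          + 2 * (dX u x t + lam * u x t) * dX S x t) := by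
    have h := (hU.dT.hasDerivAt_dX x t).const_mul c
    simp only [hUt] at h
    have hux := hu.hasDerivAt_dX x t
    have h' := h.unique
      ((((((hux.const_mul 2).fun_mul (hv.hasDerivAt_dX x t)).add_const (lam ^ 2)).fun_mul
        (hU.hasDerivAt_dX x t))).fun_sub
        ((((hu.dX.hasDerivAt_dX x t).fun_add (hux.const_mul lam)).const_mul 2).fun_mul
          (hS.hasDerivAt_dX x t)))
    linear_combination h'
  apply mul_left_cancel₀ (mul_ne_zero two_ne_zero (hSne x t))
  rw [← hU.dT_dX, hxt, hSx, hUx] at htx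
  linear_combination -htx + lam * hUt x t - 2 * u x t * hSt

/-- If the nonlinear Lax pair for NLS is compatible (all four equations hold),
then `u, v` solve the NLS system. -/
theorem nonlinear_lax_pair_implies_NLS
    (lam C : ℂ) (u v U V S : ℝ → ℝ → ℂ)
    (hu : Smooth2 u) (hv : Smooth2 v) (hU : Smooth2 U) (hV : Smooth2 V) (hS : Smooth2 S)
    (hSne : ∀ x t, S x t ≠ 0)
    (hS2 : ∀ x t, (S x t) ^ 2 = C - U x t * V x t)
    (hUx : ∀ x t, dX U x t = lam * U x t - 2 * u x t * S x t)
    (hVx : ∀ x t, dX V x t = -lam * V x t - 2 * v x t * S x t)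
    (hUt : ∀ x t, I * dT U x t =
      (2 * u x t * v x t + lam ^ 2) * U x t - 2 * (dX u x t + lam * u x t) * S x t)
    (hVt : ∀ x t, I * dT V x t =
      -(2 * u x t * v x t + lam ^ 2) * V x t + 2 * (dX v x t - lam * v x t) * S x t) :
    (∀ x t, I * dT u x t = dX (dX u) x t + 2 * (u x t) ^ 2 * v x t) ∧
    (∀ x t, I * dT v x t = -(dX (dX v) x t) - 2 * (v x t) ^ 2 * u x t) := by
  refine ⟨evolution_of_compatible I lam C u v U V S hu hv hU hV hS hSne hS2 hUx hVx hUt hVt,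
    fun x t => ?_⟩
  have h := evolution_of_compatible (-I) (-lam) C v u V U S hv hu hV hU hS hSne
    (fun x t => by rw [hS2, mul_comm]) hVx (fun x t => by rw [hUx, neg_neg])
    (fun x t => by linear_combination -hVt x t) (fun x t => by linear_combination -hUt x t) x t
  linear_combination -h
end

section
/- Fix N ≥ 1, complex numbers λ_1, …, λ_{2N+2}, set c = (1/2)·Σ_{k=1}^{2N+2} λ_k and P(z) = Π_{k=1}^{2N+2}(z − λ_k). Let Ω ⊂ ℂ^N × ℂ^N be the open set of pairs (γ, n) with γ_1, …, γ_N pairwise distinct and all n_j ≠ 0. Define holomorphic vector fields X and Y on Ω by: the γ_j-component of X is F_j(γ,n) = n_j / Π_{k≠j}(γ_j − γ_k) and its n_j-component is F_j·P'(γ_j)/(2n_j); the γ_j-component of Y is G_j(γ,n) = −i·(c − Σ_{k≠j} γ_k)·F_j(γ,n) and its n_j-component is G_j·P'(γ_j)/(2n_j). Then the Lie bracket of X and Y vanishes identically on Ω, i.e., at every point p ∈ Ω, DY(p)[X(p)] − DX(p)[Y(p)] = 0. (This expresses the compatibility of the Dubrovin systems γ_j' = ν(γ_j)/Π_{k≠j}(γ_j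 − γ_k) and i·γ̇_j = (−Σ_{k≠j}γ_k + c)·ν(γ_j)/Π_{k≠j}(γ_j − γ_k), where ν(γ_j)² = P(γ_j), Theorem 2 of the paper.) -/
open Complex Finset

/-- The polynomial `P(z) = ∏ (z − λ_k)`. -/
noncomputable def Ppoly (N : ℕ) (lam : Fin (2 * N + 2) → ℂ) (z : ℂ) : ℂ :=
  ∏ k, (z - lam k)

/-- `F_j(γ,n) = n_j / ∏_{k≠j} (γ_j − γ_k)`. -/
noncomputable def Fcomp (N : ℕ) (p : (Fin N → ℂ) × (Fin N → ℂ)) (j : Fin N) : ℂ :=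
  p.2 j / ∏ k ∈ Finset.univ.erase j, (p.1 j - p.1 k)

/-- The Dubrovin `x`-flow vector field. -/
noncomputable def Xfield (N : ℕ) (lam : Fin (2 * N + 2) → ℂ)
    (p : (Fin N → ℂ) × (Fin N → ℂ)) : (Fin N → ℂ) × (Fin N → ℂ) :=
  (fun j => Fcomp N p j,
   fun j => Fcomp N p j * deriv (Ppoly N lam) (p.1 j) / (2 * p.2 j))

/-- The Dubrovin `t`-flow vector field, with
`G_j = −i (c − ∑_{k≠j} γ_k) F_j`, `c = (1/2) ∑ λ_k`. -/
noncomputable def Yfield (N : ℕ) (lam : Fin (2 * N + 2) → ℂ)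
    (p : (Fin N → ℂ) × (Fin N → ℂ)) : (Fin N → ℂ) × (Fin N → ℂ) :=
  (fun j => -I * ((1 / 2) * ∑ k, lam k - ∑ k ∈ Finset.univ.erase j, p.1 k) * Fcomp N p j,
   fun j => -I * ((1 / 2) * ∑ k, lam k - ∑ k ∈ Finset.univ.erase j, p.1 k) * Fcomp N p j
      * deriv (Ppoly N lam) (p.1 j) / (2 * p.2 j))

/-- The slope `P'(γ_j) / (2 n_j)` of `n_j` with respect to `γ_j` along both Dubrovin flows. -/
noncomputable def dubrovinSlope (N : ℕ) (lam : Fin (2 * N + 2) → ℂ)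
    (p : (Fin N → ℂ) × (Fin N → ℂ)) (j : Fin N) : ℂ :=
  deriv (Ppoly N lam) (p.1 j) / (2 * p.2 j)

/-- The factor `−i (c − ∑_{k≠j} γ_k)` relating the `t`-flow to the `x`-flow. -/
noncomputable def dubrovinFactor (N : ℕ) (lam : Fin (2 * N + 2) → ℂ)
    (p : (Fin N → ℂ) × (Fin N → ℂ)) (j : Fin N) : ℂ :=
  -I * ((1 / 2) * ∑ k, lam k - ∑ k ∈ Finset.univ.erase j, p.1 k)

lemma contDiff_Ppoly (N : ℕ) (lam : Fin (2 * N + 2) → ℂ) : ContDiff ℂ 2 (Ppoly N lam) := by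
  unfold Ppoly
  fun_prop

lemma differentiable_deriv_Ppoly (N : ℕ) (lam : Fin (2 * N + 2) → ℂ) :
    Differentiable ℂ (deriv (Ppoly N lam)) :=
  (ContDiff.deriv' (n := 1) (contDiff_Ppoly N lam)).differentiable one_ne_zero

lemma exists_hasFDerivAt_div {E : Type*} [NormedAddCommGroup E] [NormedSpace ℂ E]
    {f g : E → ℂ} {f' g' : E →L[ℂ] ℂ} {x : E} (hf : HasFDerivAt f f' x)
    (hg : HasFDerivAt g g' x) (hx : g x ≠ 0) :
    ∃ L : E →L[ℂ] ℂ, HasFDerivAt (fun y => f y / g y) L x ∧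
      ∀ v, L v = (f' v * g x - f x * g' v) / g x ^ 2 := by
  simp only [div_eq_mul_inv]
  refine ⟨_, hf.fun_mul ((hasDerivAt_inv hx).comp_hasFDerivAt x hg), fun v => ?_⟩
  simp only [add_apply, smul_apply, smul_eq_mul]
  field_simp
  ring

lemma hasFDerivAt_fst_apply {N : ℕ} (p : (Fin N → ℂ) × (Fin N → ℂ)) (j : Fin N) :
    HasFDerivAt (fun q : (Fin N → ℂ) × (Fin N → ℂ) => q.1 j)
      ((ContinuousLinearMap.proj j).comp
        (ContinuousLinearMap.fst ℂ (Fin N → ℂ) (Fin N → ℂ))) p :=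
  ((ContinuousLinearMap.proj (R := ℂ) (φ := fun _ : Fin N => ℂ) j).comp
    (ContinuousLinearMap.fst ℂ (Fin N → ℂ) (Fin N → ℂ))).hasFDerivAt

lemma hasFDerivAt_snd_apply {N : ℕ} (p : (Fin N → ℂ) × (Fin N → ℂ)) (j : Fin N) :
    HasFDerivAt (fun q : (Fin N → ℂ) × (Fin N → ℂ) => q.2 j)
      ((ContinuousLinearMap.proj j).comp
        (ContinuousLinearMap.snd ℂ (Fin N → ℂ) (Fin N → ℂ))) p :=
  ((ContinuousLinearMap.proj (R := ℂ) (φ := fun _ : Fin N => ℂ) j).comp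
    (ContinuousLinearMap.snd ℂ (Fin N → ℂ) (Fin N → ℂ))).hasFDerivAt

/-- Logarithmic derivative of `F_j`. -/
lemma exists_hasFDerivAt_Fcomp {N : ℕ} {p : (Fin N → ℂ) × (Fin N → ℂ)} {j : Fin N}
    (hdist : ∀ k, j ≠ k → p.1 j ≠ p.1 k) (hn : p.2 j ≠ 0) :
    ∃ L : (Fin N → ℂ) × (Fin N → ℂ) →L[ℂ] ℂ,
      HasFDerivAt (fun q => Fcomp N q j) L p ∧
      ∀ v, L v = Fcomp N p j *
        (v.2 j / p.2 j - ∑ k ∈ univ.erase j, (v.1 j - v.1 k) / (p.1 j - p.1 k)) := by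
  have hne : ∀ k ∈ univ.erase j, p.1 j - p.1 k ≠ 0 := fun k hk =>
    sub_ne_zero.2 (hdist k (ne_of_mem_erase hk).symm)
  have hQ : ∏ k ∈ univ.erase j, (p.1 j - p.1 k) ≠ 0 := prod_ne_zero_iff.2 hne
  have hprod := HasFDerivAt.finsetProd (u := univ.erase j) fun k _ =>
    (hasFDerivAt_fst_apply p j).fun_sub (hasFDerivAt_fst_apply p k)
  obtain ⟨L, hL, hL'⟩ := exists_hasFDerivAt_div (hasFDerivAt_snd_apply p j) hprod hQ
  refine ⟨L, hL, fun v => ?_⟩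
  rw [hL']
  have hsum : ∑ k ∈ univ.erase j,
        (∏ l ∈ (univ.erase j).erase k, (p.1 j - p.1 l)) * (v.1 j - v.1 k) =
      (∏ k ∈ univ.erase j, (p.1 j - p.1 k)) *
        ∑ k ∈ univ.erase j, (v.1 j - v.1 k) / (p.1 j - p.1 k) := by
    rw [mul_sum]
    refine sum_congr rfl fun k hk => ?_
    rw [← mul_prod_erase _ _ hk]
    field_simp [hne k hk]
  simp only [Fcomp, ContinuousLinearMap.coe_comp, _root_.sum_apply, smul_apply, sub_apply,
    Function.comp_apply,
    ContinuousLinearMap.proj_apply, ContinuousLinearMap.coe_fst', ContinuousLinearMap.coe_snd',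
    smul_eq_mul, hsum]
  field_simp

lemma exists_hasFDerivAt_dubrovinSlope {N : ℕ} (lam : Fin (2 * N + 2) → ℂ)
    {p : (Fin N → ℂ) × (Fin N → ℂ)} {j : Fin N} (hn : p.2 j ≠ 0) :
    ∃ (L : (Fin N → ℂ) × (Fin N → ℂ) →L[ℂ] ℂ) (a b : ℂ),
      HasFDerivAt (fun q => dubrovinSlope N lam q j) L p ∧
      ∀ v, L v = a * v.1 j + b * v.2 j := by
  have hP := (differentiable_deriv_Ppoly N lam (p.1 j)).hasDerivAt.comp_hasFDerivAt p
    (hasFDerivAt_fst_apply p j)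
  obtain ⟨L, hL, hL'⟩ := exists_hasFDerivAt_div hP ((hasFDerivAt_snd_apply p j).const_mul 2)
    (mul_ne_zero two_ne_zero hn)
  refine ⟨L, deriv (deriv (Ppoly N lam)) (p.1 j) / (2 * p.2 j),
    -deriv (Ppoly N lam) (p.1 j) / (2 * p.2 j ^ 2), hL, fun v => ?_⟩
  rw [hL']
  simp only [Function.comp_apply, ContinuousLinearMap.coe_comp, smul_apply,
    ContinuousLinearMap.proj_apply, ContinuousLinearMap.coe_fst', ContinuousLinearMap.coe_snd',
    smul_eq_mul]
  field_simp
  ring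

lemma exists_hasFDerivAt_dubrovinFactor {N : ℕ} (lam : Fin (2 * N + 2) → ℂ)
    (p : (Fin N → ℂ) × (Fin N → ℂ)) (j : Fin N) :
    ∃ L : (Fin N → ℂ) × (Fin N → ℂ) →L[ℂ] ℂ,
      HasFDerivAt (fun q => dubrovinFactor N lam q j) L p ∧
      ∀ v, L v = I * ∑ k ∈ univ.erase j, v.1 k := by
  refine ⟨_, ((HasFDerivAt.fun_sum fun k (_ : k ∈ univ.erase j) =>
    hasFDerivAt_fst_apply p k).const_sub _).const_mul _, fun v => ?_⟩
  simp [sum_erase_eq_sub]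
  ring

lemma dubrovinFactor_sub {N : ℕ} (lam : Fin (2 * N + 2) → ℂ)
    (p : (Fin N → ℂ) × (Fin N → ℂ)) (j k : Fin N) :
    dubrovinFactor N lam p j - dubrovinFactor N lam p k = -I * (p.1 j - p.1 k) := by
  simp only [dubrovinFactor, sum_erase_eq_sub (mem_univ _)]
  ring

/-- The derivative of a vector field whose two components are related by the slopes. -/
lemma hasFDerivAt_prodMk_slope {N : ℕ} {p : (Fin N → ℂ) × (Fin N → ℂ)}
    {h D : (Fin N → ℂ) × (Fin N → ℂ) → Fin N → ℂ}
    {h' D' : Fin N → ((Fin N → ℂ) × (Fin N → ℂ) →L[ℂ] ℂ)}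
    (hh : ∀ j, HasFDerivAt (fun q => h q j) (h' j) p)
    (hD : ∀ j, HasFDerivAt (fun q => D q j) (D' j) p) :
    HasFDerivAt (fun q => ((fun j => h q j, fun j => h q j * D q j) :
        (Fin N → ℂ) × (Fin N → ℂ)))
      ((ContinuousLinearMap.pi h').prod
        (ContinuousLinearMap.pi fun j => h p j • D' j + D p j • h' j)) p :=
  (hasFDerivAt_pi.2 hh).prodMk (hasFDerivAt_pi.2 fun j => (hh j).fun_mul (hD j))

lemma Xfield_eq (N : ℕ) (lam : Fin (2 * N + 2) → ℂ) :
    Xfield N lam = fun q => (fun j => Fcomp N q j,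
      fun j => Fcomp N q j * dubrovinSlope N lam q j) := by
  funext q
  simp only [Xfield, dubrovinSlope, mul_div_assoc]

lemma Yfield_eq (N : ℕ) (lam : Fin (2 * N + 2) → ℂ) :
    Yfield N lam = fun q => (fun j => dubrovinFactor N lam q j * Fcomp N q j,
      fun j => dubrovinFactor N lam q j * Fcomp N q j * dubrovinSlope N lam q j) := by
  funext q
  simp only [Yfield, dubrovinSlope, dubrovinFactor, mul_div_assoc]

/-- The Dubrovin `x`-flow and `t`-flow vector fields commute on the open set `Ω`
of points with pairwise distinct `γ_j` and nonzero `n_j`. -/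
theorem dubrovin_fields_commute (N : ℕ) (hN : 1 ≤ N) (lam : Fin (2 * N + 2) → ℂ)
    (p : (Fin N → ℂ) × (Fin N → ℂ))
    (hdist : ∀ j k : Fin N, j ≠ k → p.1 j ≠ p.1 k)
    (hn : ∀ j : Fin N, p.2 j ≠ 0) :
    fderiv ℂ (Yfield N lam) p (Xfield N lam p)
      - fderiv ℂ (Xfield N lam) p (Yfield N lam p) = 0 := by
  choose F' hF hF' using fun j => exists_hasFDerivAt_Fcomp (hdist j) (hn j)
  choose D' a b hD hD' using fun j => exists_hasFDerivAt_dubrovinSlope lam (hn j)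
  choose g' hg hg' using exists_hasFDerivAt_dubrovinFactor lam p
  have hX := hasFDerivAt_prodMk_slope hF hD
  have hY := hasFDerivAt_prodMk_slope
    (h := fun q j => dubrovinFactor N lam q j * Fcomp N q j) (fun j => (hg j).fun_mul (hF j)) hD
  have hγ : ∀ j, dubrovinFactor N lam p j * F' j (Xfield N lam p)
      + Fcomp N p j * g' j (Xfield N lam p) - F' j (Yfield N lam p) = 0 := by
    intro j
    have hsum : ∑ k ∈ univ.erase j,
          (dubrovinFactor N lam p j * Fcomp N p j - dubrovinFactor N lam p k * Fcomp N p k)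
            / (p.1 j - p.1 k) =
        dubrovinFactor N lam p j *
            ∑ k ∈ univ.erase j, (Fcomp N p j - Fcomp N p k) / (p.1 j - p.1 k)
          - I * ∑ k ∈ univ.erase j, Fcomp N p k := by
      rw [mul_sum, mul_sum, ← sum_sub_distrib]
      refine sum_congr rfl fun k hk => ?_
      have hne := sub_ne_zero.2 (hdist j k (ne_of_mem_erase hk).symm)
      field_simp
      linear_combination Fcomp N p k * dubrovinFactor_sub lam p j k
    simp only [hF', hg', Xfield_eq, Yfield_eq, hsum]
    ring
  rw [← Xfield_eq N lam] at hX
  rw [← Yfield_eq N lam] at hY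
  rw [hX.fderiv, hY.fderiv]
  ext j
  · simpa using hγ j
  · have hslope : dubrovinFactor N lam p j * D' j (Xfield N lam p) = D' j (Yfield N lam p) := by
      simp only [hD', Xfield_eq, Yfield_eq]
      ring
    simp only [Prod.snd_sub, Prod.snd_zero, Pi.sub_apply, Pi.zero_apply,
      ContinuousLinearMap.prod_apply, ContinuousLinearMap.coe_pi',
      add_apply, smul_apply, smul_eq_mul]
    linear_combination dubrovinSlope N lam p j * hγ j + Fcomp N p j * hslope
end

section
/- Let N ≥ 1, let λ_1, …, λ_{2N+2} ∈ ℂ, and set 4C(λ) = Π_{k=1}^{2N+2}(λ − λ_k). Let γ_1, …, γ_N, β_1, …, β_N, u, v be differentiable complex-valued functions of x on an open interval, with u nowhere zero, and set Φ(λ,x) = Π_{k=1}^N (λ − γ_k(x)), Ψ(λ,x) = −Π_{k=1}^N (λ − β_k(x)). Suppose that for all λ ∈ ℂ and all x: ((u'(x)/u(x))·Φ + ∂_xΦ − λΦ)² = 4C(λ) − 4u(x)v(x)·Φ·Ψ. Then the trace formula holds: u'(x)/u(x) = −Σ_{k=1}^N γ_k(x) + (1/2)·Σ_{k=1}^{2N+2}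 λ_k. -/
open Complex Finset

open Polynomial in
/-- If `(A - D)² = L + E` with `A`, `L` monic of degrees `n + 1`, `2n + 2`, and the corrections `D`,
`E` have degrees less than `n`, at most `2n`, then the subleading coefficient of `L` is twice that
of `A`. -/
theorem Polynomial.Monic.two_mul_nextCoeff_eq_of_sq_eq {R : Type*} [CommRing R] {n : ℕ}
    {A D L E : R[X]} (hA : A.Monic) (hAdeg : A.natDegree = n + 1) (hD : D.natDegree < n)
    (hLdeg : L.natDegree = 2 * n + 2) (hE : E.natDegree ≤ 2 * n)
    (h : (A - D) ^ 2 = L + E) : 2 * A.nextCoeff = L.nextCoeff := by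
  have hAA : (A * A).natDegree = 2 * n + 2 := by
    rw [hA.natDegree_mul hA, hAdeg]
    ring
  have hAD : (A * D).natDegree ≤ 2 * n := by
    have := natDegree_mul_le (p := A) (q := D)
    omega
  have hDD : (D * D).natDegree ≤ 2 * n := by
    have := natDegree_mul_le (p := D) (q := D)
    omega
  have hnext : (A * A).nextCoeff = (A * A).coeff (2 * n + 1) := by
    rw [nextCoeff_of_natDegree_pos (by omega), hAA]
    rfl
  have hLnext : L.nextCoeff = L.coeff (2 * n + 1) := by
    rw [nextCoeff_of_natDegree_pos (by omega), hLdeg]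
    rfl
  have key : A * A = L + E + A * D + A * D - D * D := by linear_combination h
  rw [two_mul, ← hA.nextCoeff_mul hA, hnext, hLnext, key]
  simp [coeff_eq_zero_of_natDegree_lt, hE, hAD, hDD]

open Polynomial in
/-- The polynomial whose values are the derivatives in `x` of `∏ k, (l - γ k x)`. -/
theorem exists_polynomial_deriv_prod_sub {n : ℕ} {γ : Fin n → ℝ → ℂ} {x : ℝ}
    (hγ : ∀ j, DifferentiableAt ℝ (γ j) x) :
    ∃ D : ℂ[X], D.natDegree ≤ n - 1 ∧
      ∀ l, deriv (fun y => ∏ k, (l - γ k y)) x = D.eval l := by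
  refine ⟨∑ i, C (-deriv (γ i) x) * ∏ j ∈ univ.erase i, (X - C (γ j x)), ?_, fun l => ?_⟩
  · refine natDegree_sum_le_of_forall_le _ _ fun i _ => (natDegree_C_mul_le _ _).trans ?_
    rw [natDegree_finsetProd_X_sub_C_eq_card]
    simp
  · rw [(HasDerivAt.fun_finsetProd fun i _ => (hγ i).hasDerivAt.const_sub l).deriv]
    simp [eval_finsetSum, eval_prod, mul_comm]

open Polynomial in
/-- The trace formula: substituting the polynomial ansatz
`Φ(λ,x) = ∏ (λ − γ_k(x))`, `Ψ(λ,x) = −∏ (λ − β_k(x))`, `4C(λ) = ∏ (λ − λ_k)`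
into the squared nonlinear invariant manifold relation
`((u'/u)Φ + Φ_x − λΦ)² = 4C(λ) − 4uvΦΨ` yields
`u'/u = −∑ γ_k + (1/2) ∑ λ_k`. -/
theorem trace_formula (N : ℕ) (hN : 1 ≤ N) (lam : Fin (2 * N + 2) → ℂ)
    (a b : ℝ) (γ β : Fin N → ℝ → ℂ) (u v : ℝ → ℂ)
    (hγ : ∀ j, ∀ x ∈ Set.Ioo a b, DifferentiableAt ℝ (γ j) x)
    (hβ : ∀ j, ∀ x ∈ Set.Ioo a b, DifferentiableAt ℝ (β j) x)
    (hu : ∀ x ∈ Set.Ioo a b, DifferentiableAt ℝ u x)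
    (hv : ∀ x ∈ Set.Ioo a b, DifferentiableAt ℝ v x)
    (hune : ∀ x ∈ Set.Ioo a b, u x ≠ 0)
    (heq : ∀ (l : ℂ), ∀ x ∈ Set.Ioo a b,
      (deriv u x / u x * ∏ k, (l - γ k x)
        + deriv (fun y => ∏ k, (l - γ k y)) x
        - l * ∏ k, (l - γ k x)) ^ 2
      = (∏ k, (l - lam k))
        - 4 * u x * v x * (∏ k, (l - γ k x)) * (-(∏ k, (l - β k x)))) :
    ∀ x ∈ Set.Ioo a b, deriv u x / u x = -(∑ k, γ k x) + (1 / 2) * ∑ k, lam k := by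
  intro x hx
  obtain ⟨D, hD, hDeval⟩ := exists_polynomial_deriv_prod_sub fun j => hγ j x hx
  set c := deriv u x / u x
  set Φ : Polynomial ℂ := ∏ k, (X - C (γ k x)) with hΦ
  set B : Polynomial ℂ := ∏ k, (X - C (β k x)) with hB
  set L : Polynomial ℂ := ∏ k, (X - C (lam k)) with hL
  have hΦm : Φ.Monic := monic_prod_X_sub_C _ _
  have hΦdeg : Φ.natDegree = N := by simp [hΦ, natDegree_finsetProd_X_sub_C_eq_card]
  have hBdeg : B.natDegree = N := by simp [hB, natDegree_finsetProd_X_sub_C_eq_card]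
  have hLdeg : L.natDegree = 2 * N + 2 := by simp [hL, natDegree_finsetProd_X_sub_C_eq_card]
  have hAdeg : ((X - C c) * Φ).natDegree = N + 1 := by
    rw [(monic_X_sub_C c).natDegree_mul hΦm, natDegree_X_sub_C, hΦdeg, add_comm]
  have hE : (C (4 * u x * v x) * (Φ * B)).natDegree ≤ 2 * N := by
    have := natDegree_C_mul_le (4 * u x * v x) (Φ * B)
    have := natDegree_mul_le (p := Φ) (q := B)
    omega
  have hsq : ((X - C c) * Φ - D) ^ 2 = L + C (4 * u x * v x) * (Φ * B) := by
    refine Polynomial.funext fun l => ?_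
    have h := heq l x hx
    rw [hDeval] at h
    simp only [hΦ, hB, hL, eval_pow, eval_sub, eval_add, eval_mul, eval_prod, eval_X, eval_C]
    linear_combination h
  have key := ((monic_X_sub_C c).mul hΦm).two_mul_nextCoeff_eq_of_sq_eq hAdeg (by omega) hLdeg hE hsq
  rw [(monic_X_sub_C c).nextCoeff_mul hΦm, nextCoeff_X_sub_C, hΦ, hL, prod_X_sub_C_nextCoeff,
    prod_X_sub_C_nextCoeff] at key
  linear_combination (-1 / 2 : ℂ) * key
end

section
/- Let N ≥ 1, let λ_1, …, λ_{2N+2} ∈ ℂ, and set 4C(λ) = Π_{k=1}^{2N+2}(λ − λ_k). Let γ_1, …, γ_N, β_1, …, β_N, u, v be differentiable complex-valued functions of x on an open interval, with u nowhere zero, and set Φ(λ,x) = Π_{k=1}^N (λ − γ_k(x)), Ψ(λ,x) = −Π_{k=1}^N (λ − β_k(x)). Suppose that for all λ ∈ ℂ and all x: ((u'(x)/u(x))·Φ + ∂_xΦ − λΦ)² = 4C(λ) − 4u(x)v(x)·Φ·Ψ. Then for each j = 1, …, N the squared Dubrovin equation holds: (γ_j'(x))² · Π_{k≠j}(γ_j(x)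 − γ_k(x))² = Π_{k=1}^{2N+2}(γ_j(x) − λ_k). -/
open Complex Finset

/-- At a root `γ j x`, only the `j`-th term of the product rule for `∏ k, (l - γ k)` survives. -/
theorem deriv_prod_sub_at_root {ι : Type*} [Fintype ι] [DecidableEq ι] (γ : ι → ℝ → ℂ) (x : ℝ)
    (hγ : ∀ k, DifferentiableAt ℝ (γ k) x) (j : ι) :
    deriv (fun y => ∏ k, (γ j x - γ k y)) x
      = -((∏ k ∈ Finset.univ.erase j, (γ j x - γ k x)) * deriv (γ j) x) := by
  have h := HasDerivAt.fun_finsetProd (u := Finset.univ)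
    fun k _ => (hγ k).hasDerivAt.const_sub (γ j x)
  rw [h.deriv, Finset.sum_eq_single j]
  · simp
  · intro k _ hk
    rw [Finset.prod_eq_zero (Finset.mem_erase.2 ⟨hk.symm, Finset.mem_univ j⟩) (sub_self _),
      zero_smul]
  · simp

/-- The squared Dubrovin equation
`(γ_j')² ∏_{k≠j}(γ_j − γ_k)² = ∏_{k}(γ_j − λ_k)`
follows from the squared nonlinear invariant manifold relation
`((u'/u)Φ + Φ_x − λΦ)² = 4C(λ) − 4uvΦΨ` with the polynomial ansatz
`Φ(λ,x) = ∏ (λ − γ_k(x))`, `Ψ(λ,x) = −∏ (λ − β_k(x))`, `4C(λ) = ∏ (λ − λ_k)`. -/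
theorem dubrovin_x_equation (N : ℕ) (hN : 1 ≤ N) (lam : Fin (2 * N + 2) → ℂ)
    (a b : ℝ) (γ β : Fin N → ℝ → ℂ) (u v : ℝ → ℂ)
    (hγ : ∀ j, ∀ x ∈ Set.Ioo a b, DifferentiableAt ℝ (γ j) x)
    (hβ : ∀ j, ∀ x ∈ Set.Ioo a b, DifferentiableAt ℝ (β j) x)
    (hu : ∀ x ∈ Set.Ioo a b, DifferentiableAt ℝ u x)
    (hv : ∀ x ∈ Set.Ioo a b, DifferentiableAt ℝ v x)
    (hune : ∀ x ∈ Set.Ioo a b, u x ≠ 0)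
    (heq : ∀ (l : ℂ), ∀ x ∈ Set.Ioo a b,
      (deriv u x / u x * ∏ k, (l - γ k x)
        + deriv (fun y => ∏ k, (l - γ k y)) x
        - l * ∏ k, (l - γ k x)) ^ 2
      = (∏ k, (l - lam k))
        - 4 * u x * v x * (∏ k, (l - γ k x)) * (-(∏ k, (l - β k x)))) :
    ∀ (j : Fin N), ∀ x ∈ Set.Ioo a b,
      (deriv (γ j) x) ^ 2 * (∏ k ∈ Finset.univ.erase j, (γ j x - γ k x)) ^ 2
        = ∏ k, (γ j x - lam k) := by
  intro j x hx
  have hroot : ∏ k, (γ j x - γ k x) = 0 :=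
    Finset.prod_eq_zero (Finset.mem_univ j) (sub_self _)
  have h := heq (γ j x) x hx
  rw [deriv_prod_sub_at_root γ x (fun k => hγ k x hx) j, hroot] at h
  linear_combination h
end

section
/- Let η, ξ, s0 be real numbers and set λ₁ = η + iξ, λ₂ = −η + iξ. Then the function γ : ℝ² → ℂ defined by γ(x,t) = −η·tanh(ηx + 2ξηt + s0) + iξ satisfies both ordinary differential equations ∂_x γ = (γ − λ₁)(γ − λ₂) and ∂_t γ = 2ξ·(γ − λ₁)(γ − λ₂) on ℝ². -/
open Complex

theorem hasDerivAt_real_tanh (u : ℝ) : HasDerivAt Real.tanh (1 - Real.tanh u ^ 2) u := by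
  have hc : Real.cosh u ≠ 0 := (Real.cosh_pos u).ne'
  have h := (Real.hasDerivAt_sinh u).div (Real.hasDerivAt_cosh u) hc
  have hfun : Real.tanh = Real.sinh / Real.cosh := funext Real.tanh_eq_sinh_div_cosh
  rw [← hfun] at h
  refine h.congr_deriv ?_
  rw [Real.tanh_eq_sinh_div_cosh]
  field_simp

/-- Derivative of a complex affine image of `tanh` along a real curve. -/
theorem HasDerivAt.const_mul_ofReal_tanh_add {u : ℝ → ℝ} {u' y : ℝ} (hu : HasDerivAt u u' y)
    (a b : ℂ) :
    HasDerivAt (fun z => a * (Real.tanh (u z) : ℂ) + b)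
      (a * (((1 - Real.tanh (u y) ^ 2) * u' : ℝ) : ℂ)) y :=
  ((((hasDerivAt_real_tanh (u y)).comp y hu).ofReal_comp).const_mul a).add_const b

/-- The one-phase solution of the compatible pair of Dubrovin equations for NLS:
`γ(x,t) = −η tanh(ηx + 2ξηt + s₀) + iξ` satisfies
`∂ₓγ = (γ − λ₁)(γ − λ₂)` and `∂ₜγ = 2ξ(γ − λ₁)(γ − λ₂)`,
where `λ₁ = η + iξ`, `λ₂ = −η + iξ`. -/
theorem one_phase_dubrovin_solution (η ξ s0 : ℝ) :
    let lam1 : ℂ := (η : ℂ) + I * (ξ : ℂ)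
    let lam2 : ℂ := -(η : ℂ) + I * (ξ : ℂ)
    let γ : ℝ → ℝ → ℂ := fun x t =>
      -(η : ℂ) * (Real.tanh (η * x + 2 * ξ * η * t + s0) : ℂ) + I * (ξ : ℂ)
    (∀ x t, dX γ x t = (γ x t - lam1) * (γ x t - lam2)) ∧
    (∀ x t, dT γ x t = 2 * (ξ : ℂ) * ((γ x t - lam1) * (γ x t - lam2))) := by
  intro lam1 lam2 γ
  constructor
  · intro x t
    have hu : HasDerivAt (fun y : ℝ => η * y + 2 * ξ * η * t + s0) η x := by
      simpa using (((hasDerivAt_id x).const_mul η).add_const (2 * ξ * η * t)).add_const s0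
    refine (hu.const_mul_ofReal_tanh_add (-(η : ℂ)) (I * (ξ : ℂ))).deriv.trans ?_
    simp only [γ, lam1, lam2]
    push_cast
    ring
  · intro x t
    have hu : HasDerivAt (fun s : ℝ => η * x + 2 * ξ * η * s + s0) (2 * ξ * η) t := by
      simpa using (((hasDerivAt_id t).const_mul (2 * ξ * η)).const_add (η * x)).add_const s0
    refine (hu.const_mul_ofReal_tanh_add (-(η : ℂ)) (I * (ξ : ℂ))).deriv.trans ?_
    simp only [γ, lam1, lam2]
    push_cast
    ring
end
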